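/- For every real number t with -√3 ≤ t ≤ √3, the real number a = (2+t)·e^{-t} is suitable: every sign sequence represents an element of EReal, and every element of EReal is representable. Consequently, every a in the interval [(2+√3)·e^{-√3}, e] is suitable. -/

import Mathlib

open Filter Topology

/-- Exponential on the extended real line, with e^{-∞}=0 and e^{+∞}=+∞. -/
noncomputable def eexp (y : EReal) : EReal :=
  if y = ⊥ then (0 : EReal) else if y = ⊤ then ⊤ else ((Real.exp y.toReal : ℝ) : EReal)

/-- `fSgn a s` is `f₊ : x ↦ e^{a·x}` when `s = true` and `f₋ : x ↦ -e^{a·x}` when `s = false`. -/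
noncomputable def fSgn (a : ℝ) (s : Bool) (x : EReal) : EReal :=
  if s then eexp ((a : EReal) * x) else -eexp ((a : EReal) * x)

/-- `uSeq a n ε = f_{ε₁}(f_{ε₂}(⋯ f_{ε_n}(1)⋯))`, where `ε (k-1)` is the k-th sign. -/
noncomputable def uSeq (a : ℝ) : ℕ → (ℕ → Bool) → EReal
  | 0, _ => 1
  | n + 1, ε => fSgn a (ε 0) (uSeq a n (fun k => ε (k + 1)))

/-- `ε` represents `t` if `(u_{n,ε})_n` tends to `t` in `EReal`. -/
def Represents (a : ℝ) (ε : ℕ → Bool) (t : EReal) : Prop :=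
  Filter.Tendsto (fun n => uSeq a n ε) Filter.atTop (nhds t)

/-- `t` is representable if some sign sequence represents it. -/
def Representable (a : ℝ) (t : EReal) : Prop :=
  ∃ ε : ℕ → Bool, Represents a ε t

/-- For a finite word `γ = γ₁⋯γ_k`, `fWord a γ = f_{γ₁} ∘ ⋯ ∘ f_{γ_k}`. -/
noncomputable def fWord (a : ℝ) (γ : List Bool) (x : EReal) : EReal :=
  γ.foldr (fSgn a) x

/-- `I(ε) = ⋂ₙ I(n,ε)` where `I(n,ε)` is the image of `EReal` under `f_{ε₁} ∘ ⋯ ∘ f_{ε_n}`. -/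
noncomputable def Iset (a : ℝ) (ε : ℕ → Bool) : Set EReal :=
  ⋂ n : ℕ, Set.range (fWord a (List.ofFn fun i : Fin n => ε i))

/-- `X` is the union over all finite words `γ` of the images `f_γ(]m,+∞])`. -/
noncomputable def Xset (a m : ℝ) : Set EReal :=
  ⋃ γ : List Bool, fWord a γ '' Set.Ioi (m : EReal)
/-- A function on the line with positive derivative off one point is strictly increasing. -/
theorem strictMono_of_deriv_pos_off {f f' : ℝ → ℝ} (c : ℝ) (hf : ∀ x, HasDerivAt f (f' x) x)
    (hpos : ∀ x, x ≠ c → 0 < f' x) : StrictMono f := by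
  have hc : Continuous f := continuous_iff_continuousAt.2 fun x => (hf x).continuousAt
  apply StrictMonoOn.Iic_union_Ici (a := c)
  · apply strictMonoOn_of_deriv_pos (convex_Iic c) hc.continuousOn
    intro x hx
    rw [interior_Iic] at hx
    rw [(hf x).deriv]
    exact hpos x (ne_of_lt hx)
  · apply strictMonoOn_of_deriv_pos (convex_Ici c) hc.continuousOn
    intro x hx
    rw [interior_Ici] at hx
    rw [(hf x).deriv]
    exact hpos x (ne_of_gt hx)

theorem key_ineq (t : ℝ) (h2 : 0 < 2 + t) (h3 : t ^ 2 ≤ 3) (u : ℝ) (hu : u ≠ 0) :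
    4 + u ^ 2 + 2 * u * t < (2 + t) * Real.exp u + (2 - t) * Real.exp (-u) := by
  set H : ℝ → ℝ := fun u =>
    (2 + t) * Real.exp u + (2 - t) * Real.exp (-u) - (4 + u ^ 2 + 2 * u * t) with hH
  set H1 : ℝ → ℝ := fun u =>
    (2 + t) * Real.exp u - (2 - t) * Real.exp (-u) - (2 * u + 2 * t) with hH1
  have he : ∀ x : ℝ, HasDerivAt (fun u : ℝ => Real.exp (-u)) (-Real.exp (-x)) x := by
    intro x
    have := (hasDerivAt_neg x).exp
    simpa using this
  have dH : ∀ x, HasDerivAt H (H1 x) x := by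
    intro x
    have h := ((((Real.hasDerivAt_exp x).const_mul (2 + t)).add ((he x).const_mul (2 - t))).sub
      (((hasDerivAt_const x (4 : ℝ)).add (hasDerivAt_pow 2 x)).add
        (((hasDerivAt_id x).const_mul 2).mul_const t)))
    refine h.congr_deriv ?_
    simp only [hH1]
    norm_num
    ring
  have dH1 : ∀ x, HasDerivAt H1 ((2 + t) * Real.exp x + (2 - t) * Real.exp (-x) - 2) x := by
    intro x
    have h := ((((Real.hasDerivAt_exp x).const_mul (2 + t)).sub ((he x).const_mul (2 - t))).sub
      (((hasDerivAt_id x).const_mul 2).add (hasDerivAt_const x (2 * t))))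
    refine h.congr_deriv ?_
    norm_num
  have m1 : StrictMono H1 := by
    refine strictMono_of_deriv_pos_off (-Real.log (2 + t)) dH1 ?_
    intro x hx
    have hE : 0 < Real.exp x := Real.exp_pos x
    have hz : (2 + t) * Real.exp x ≠ 1 := by
      intro h
      apply hx
      have : Real.log ((2 + t) * Real.exp x) = 0 := by rw [h, Real.log_one]
      rw [Real.log_mul h2.ne' hE.ne', Real.log_exp] at this
      linarith
    have hpos : 0 < ((2 + t) * Real.exp x - 1) ^ 2 := by
      have := sub_ne_zero.2 hz
      positivity
    rw [Real.exp_neg]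
    have e1 : (2 + t) * Real.exp x + (2 - t) * (Real.exp x)⁻¹ - 2
        = ((((2 + t) * Real.exp x) - 1) ^ 2 + (3 - t ^ 2)) / ((2 + t) * Real.exp x) := by
      field_simp
      ring
    rw [e1]
    apply div_pos <;> [linarith; positivity]
  have h10 : H1 0 = 0 := by simp [hH1]; ring
  have h00 : H 0 = 0 := by simp [hH]; ring
  have hc : Continuous H := continuous_iff_continuousAt.2 fun x => (dH x).continuousAt
  have : 0 < H u := by
    rcases lt_or_gt_of_ne hu with h | h
    · have : StrictAntiOn H (Set.Iic 0) := by
        apply strictAntiOn_of_deriv_neg (convex_Iic 0) hc.continuousOn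
        intro x hx
        rw [interior_Iic] at hx
        rw [(dH x).deriv, ← h10]
        exact m1 hx
      rw [← h00]
      exact this (Set.mem_Iic.2 h.le) (Set.mem_Iic.2 le_rfl) h
    · have : StrictMonoOn H (Set.Ici 0) := by
        apply strictMonoOn_of_deriv_pos (convex_Ici 0) hc.continuousOn
        intro x hx
        rw [interior_Ici] at hx
        rw [(dH x).deriv, ← h10]
        exact m1 hx
      rw [← h00]
      exact this (Set.mem_Ici.2 le_rfl) (Set.mem_Ici.2 h.le) h
  simp only [hH] at this
  linarith

/-- The strict monotonicity of the difference of the two arctangent coordinates. -/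
theorem diff_strictMono (t : ℝ) (h2 : 0 < 2 + t) (h3 : t ^ 2 ≤ 3) (a c : ℝ)
    (ha : a = (2 + t) * Real.exp (-t)) (hc : c = a / Real.sqrt (4 - t ^ 2)) :
    StrictMono fun x : ℝ => Real.arctan (c * x) - Real.arctan (c * Real.exp (a * x)) := by
  have ha0 : 0 < a := by rw [ha]; positivity
  have hb : 0 < 4 - t ^ 2 := by linarith
  have hc0 : 0 < c := by rw [hc]; positivity
  have hc2 : c ^ 2 * (4 - t ^ 2) = a ^ 2 := by
    rw [hc, div_pow, Real.sq_sqrt hb.le]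
    field_simp
  have d1 : ∀ x : ℝ, HasDerivAt (fun x : ℝ => Real.arctan (c * x))
      (1 / (1 + (c * x) ^ 2) * c) x := by
    intro x
    simpa using ((hasDerivAt_id x).const_mul c).arctan
  have d2 : ∀ x : ℝ, HasDerivAt (fun x : ℝ => Real.arctan (c * Real.exp (a * x)))
      (1 / (1 + (c * Real.exp (a * x)) ^ 2) * (c * (Real.exp (a * x) * a))) x := by
    intro x
    simpa using ((((hasDerivAt_id x).const_mul a).exp).const_mul c).arctan
  refine strictMono_of_deriv_pos_off (t / a) (fun x => (d1 x).sub (d2 x)) ?_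
  intro x hx
  have hu : a * x - t ≠ 0 := by
    intro h
    apply hx
    field_simp
    linarith
  have k := key_ineq t h2 h3 (a * x - t) hu
  set y := a * Real.exp (a * x) with hy
  have hy0 : 0 < y := by positivity
  have e1 : (2 + t) * Real.exp (a * x - t) = y := by
    rw [hy, sub_eq_add_neg, Real.exp_add]
    have e0 : a * Real.exp (a * x) = (2 + t) * Real.exp (-t) * Real.exp (a * x) :=
      congrArg (fun z => z * Real.exp (a * x)) ha
    rw [e0]
    ring
  have e2 : (2 - t) * Real.exp (-(a * x - t)) = (4 - t ^ 2) / y := by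
    rw [← e1, Real.exp_neg]
    field_simp
    ring
  rw [e1, e2] at k
  have k2 : y * ((4 - t ^ 2) + (a * x) ^ 2) < y ^ 2 + (4 - t ^ 2) := by
    have := mul_lt_mul_of_pos_left k hy0
    have e3 : y * (y + (4 - t ^ 2) / y) = y ^ 2 + (4 - t ^ 2) := by field_simp
    rw [e3] at this
    linarith
  have k3 : y * (1 + (c * x) ^ 2) < 1 + (c * Real.exp (a * x)) ^ 2 := by
    have hx2 : (4 - t ^ 2) * (c * x) ^ 2 = (a * x) ^ 2 := by
      rw [mul_pow, mul_pow, ← hc2]; ring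
    have hy2 : (4 - t ^ 2) * (c * Real.exp (a * x)) ^ 2 = y ^ 2 := by
      rw [hy, mul_pow, mul_pow, ← hc2]; ring
    refine lt_of_mul_lt_mul_left ?_ hb.le
    nlinarith
  rw [sub_pos, one_div_mul_eq_div, one_div_mul_eq_div, div_lt_div_iff₀ (by positivity)
    (by positivity)]
  have := mul_lt_mul_of_pos_left k3 hc0
  rw [hy] at this
  linarith

theorem eexp_eq (y : EReal) : eexp y = ((EReal.exp y : ENNReal) : EReal) := by
  induction y with
  | bot => simp [eexp]
  | top => simp [eexp]
  | coe r => simp [eexp, (Real.exp_pos r).le]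

theorem fSgn_false (a : ℝ) (x : EReal) : fSgn a false x = -fSgn a true x := by simp [fSgn]

theorem fSgn_true_coe (a x : ℝ) : fSgn a true (x : EReal) = ((Real.exp (a * x) : ℝ) : EReal) := by
  simp only [fSgn, if_true]
  rw [← EReal.coe_mul, eexp, if_neg (EReal.coe_ne_bot _), if_neg (EReal.coe_ne_top _),
    EReal.toReal_coe]

theorem fSgn_true_mono (a : ℝ) (ha : 0 < a) : Monotone (fSgn a true) := by
  intro x y h
  simp only [fSgn, if_true, eexp_eq]
  have ha' : (0 : EReal) ≤ (a : EReal) := by exact_mod_cast ha.le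
  have h1 : (a : EReal) * x ≤ a * y := mul_le_mul_of_nonneg_left h ha'
  exact EReal.coe_ennreal_le_coe_ennreal_iff.2 (EReal.exp_monotone h1)

theorem fSgn_continuous (a : ℝ) (ha : 0 < a) (s : Bool) : Continuous (fSgn a s) := by
  have ht : Continuous (fSgn a true) := by
    have h1 : Continuous fun x : EReal => (a : EReal) * x := by
      rw [continuous_iff_continuousAt]
      intro x
      have ha' : (a : EReal) ≠ 0 := by exact_mod_cast ha.ne'
      have h := EReal.continuousAt_mul (p := ((a : EReal), x)) (Or.inl ha') (Or.inl ha')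
        (Or.inl (EReal.coe_ne_bot a)) (Or.inl (EReal.coe_ne_top a))
      exact ContinuousAt.comp (f := fun x : EReal => ((a : EReal), x)) h (by fun_prop)
    have : fSgn a true = fun x : EReal => ((EReal.exp ((a : EReal) * x) : ENNReal) : EReal) := by
      funext x
      simp [fSgn, eexp_eq]
    rw [this]
    exact continuous_coe_ennreal_ereal.comp (ENNReal.continuous_exp.comp h1)
  cases s with
  | true => exact ht
  | false =>
    have : fSgn a false = fun x => -fSgn a true x := funext (fSgn_false a)
    rw [this]
    exact ht.neg

theorem fSgn_true_surj (a : ℝ) (ha : 0 < a) (x : EReal) (hx : 0 ≤ x) :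
    ∃ y, fSgn a true y = x := by
  induction x with
  | bot => simp at hx
  | top => exact ⟨⊤, by simp [fSgn, EReal.coe_mul_top_of_pos ha, eexp]⟩
  | coe r =>
    have hr : 0 ≤ r := by exact_mod_cast hx
    rcases hr.eq_or_lt with h | h
    · exact ⟨⊥, by simp [fSgn, EReal.coe_mul_bot_of_pos ha, eexp, ← h]⟩
    · refine ⟨((Real.log r / a : ℝ) : EReal), ?_⟩
      rw [fSgn_true_coe, mul_div_cancel₀ _ ha.ne', Real.exp_log h]

theorem fSgn_surj (a : ℝ) (ha : 0 < a) (x : EReal) : ∃ p : Bool × EReal, fSgn a p.1 p.2 = x := by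
  rcases le_total 0 x with h | h
  · obtain ⟨y, hy⟩ := fSgn_true_surj a ha x h
    exact ⟨(true, y), hy⟩
  · obtain ⟨y, hy⟩ := fSgn_true_surj a ha (-x) (by simpa using h)
    exact ⟨(false, y), by rw [fSgn_false, hy, neg_neg]⟩

/-- Coordinate on the extended line. -/
noncomputable def phiC (c : ℝ) (x : EReal) : ℝ :=
  if x = ⊥ then -(Real.pi / 2) else if x = ⊤ then Real.pi / 2 else Real.arctan (c * x.toReal)

theorem phiC_coe (c x : ℝ) : phiC c (x : EReal) = Real.arctan (c * x) := by simp [phiC]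

theorem phiC_neg (c : ℝ) (x : EReal) : phiC c (-x) = -phiC c x := by
  induction x with
  | bot => simp [phiC]
  | top => simp [phiC]
  | coe r => rw [← EReal.coe_neg, phiC_coe, phiC_coe, mul_neg, Real.arctan_neg]

theorem phiC_continuous (c : ℝ) (hc : 0 < c) : Continuous (phiC c) := by
  rw [continuous_iff_continuousAt]
  intro x
  have hcomp : phiC c ∘ Real.toEReal = fun x : ℝ => Real.arctan (c * x) :=
    funext fun x => phiC_coe c x
  induction x with
  | bot =>
    rw [continuousAt_iff_punctured_nhds, EReal.nhdsWithin_bot, tendsto_map'_iff, hcomp]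
    have : phiC c ⊥ = -(Real.pi / 2) := by simp [phiC]
    rw [this]
    exact (Real.tendsto_arctan_atBot.mono_right nhdsWithin_le_nhds).comp
      (tendsto_id.const_mul_atBot hc)
  | top =>
    rw [continuousAt_iff_punctured_nhds, EReal.nhdsWithin_top, tendsto_map'_iff, hcomp]
    have : phiC c ⊤ = Real.pi / 2 := by simp [phiC]
    rw [this]
    exact (Real.tendsto_arctan_atTop.mono_right nhdsWithin_le_nhds).comp
      (tendsto_id.const_mul_atTop hc)
  | coe r =>
    rw [ContinuousAt, EReal.nhds_coe, tendsto_map'_iff, hcomp, phiC_coe]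
    have : Continuous fun x : ℝ => Real.arctan (c * x) := by fun_prop
    exact this.tendsto r

theorem ereal_strictMono {D : EReal → ℝ} (hD : Continuous D)
    (hm : StrictMono fun x : ℝ => D (x : EReal)) : StrictMono D := by
  intro x y hxy
  obtain ⟨p, hxp, hpy⟩ := EReal.lt_iff_exists_real_btwn.1 hxy
  obtain ⟨q, hpq, hqy⟩ := EReal.lt_iff_exists_real_btwn.1 hpy
  have hpq' : p < q := by exact_mod_cast hpq
  have h1 : D x ≤ D p := by
    induction x with
    | top => simp at hxp
    | coe r => exact (hm (by exact_mod_cast hxp : r < p)).le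
    | bot =>
      have ht : Tendsto (fun r : ℝ => D (r : EReal)) atBot (𝓝 (D ⊥)) :=
        (hD.tendsto ⊥).comp (EReal.tendsto_coe_nhds_bot_iff.2 tendsto_id)
      refine le_of_tendsto ht ?_
      filter_upwards [eventually_lt_atBot p] with r hr using (hm hr).le
  have h2 : D q ≤ D y := by
    induction y with
    | bot => simp at hqy
    | coe r => exact (hm (by exact_mod_cast hqy : q < r)).le
    | top =>
      have ht : Tendsto (fun r : ℝ => D (r : EReal)) atTop (𝓝 (D ⊤)) :=
        (hD.tendsto ⊤).comp (EReal.tendsto_coe_nhds_top_iff.2 tendsto_id)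
      refine ge_of_tendsto ht ?_
      filter_upwards [eventually_gt_atTop q] with r hr using (hm hr).le
  exact h1.trans_lt ((hm hpq').trans_le h2)

/-- Composition along the first `n` signs. -/
noncomputable def wF (a : ℝ) : ℕ → (ℕ → Bool) → EReal → EReal
  | 0, _, x => x
  | n + 1, ε, x => fSgn a (ε 0) (wF a n (fun k => ε (k + 1)) x)

theorem uSeq_eq (a : ℝ) (n : ℕ) (ε : ℕ → Bool) : uSeq a n ε = wF a n ε 1 := by
  induction n generalizing ε with
  | zero => rfl
  | succ n ih => simp only [uSeq, wF, ih]

theorem wF_add (a : ℝ) (n k : ℕ) (ε : ℕ → Bool) (x : EReal) :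
    wF a (n + k) ε x = wF a n ε (wF a k (fun j => ε (j + n)) x) := by
  induction n generalizing ε with
  | zero => simp [wF]
  | succ n ih =>
    rw [Nat.succ_add]
    simp only [wF, ih]
    congr 4

theorem suitable_of_contract (a : ℝ) (ha : 0 < a) (φ : EReal → ℝ) (hφ : Continuous φ)
    (hinj : Function.Injective φ)
    (hcon : ∀ s x y, x ≠ y → |φ (fSgn a s x) - φ (fSgn a s y)| < |φ x - φ y|) :
    (∀ ε : ℕ → Bool, ∃ s : EReal, Represents a ε s) ∧ ∀ s : EReal, Representable a s := by
  have hemb : IsClosedEmbedding φ := hφ.isClosedEmbedding hinj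
  have hle : ∀ s x y, |φ (fSgn a s x) - φ (fSgn a s y)| ≤ |φ x - φ y| := by
    intro s x y
    by_cases h : x = y
    · simp [h]
    · exact (hcon s x y h).le
  -- uniform gain
  have gain1 : ∀ δ > 0, ∀ s, ∃ η > 0, ∀ x y, δ ≤ |φ x - φ y| →
      |φ (fSgn a s x) - φ (fSgn a s y)| ≤ |φ x - φ y| - η := by
    intro δ hδ s
    have hf := fSgn_continuous a ha s
    set G : EReal × EReal → ℝ := fun p =>
      |φ p.1 - φ p.2| - |φ (fSgn a s p.1) - φ (fSgn a s p.2)| with hG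
    have hGc : Continuous G := by fun_prop
    set K : Set (EReal × EReal) := {p | δ ≤ |φ p.1 - φ p.2|} with hK
    have hKc : IsCompact K := (isClosed_le continuous_const (by fun_prop)).isCompact
    rcases K.eq_empty_or_nonempty with h | h
    · refine ⟨1, one_pos, fun x y hxy => ?_⟩
      have : (x, y) ∈ K := hxy
      rw [h] at this
      exact this.elim
    · obtain ⟨p, hp, hmin⟩ := hKc.exists_isMinOn h hGc.continuousOn
      refine ⟨G p, ?_, fun x y hxy => ?_⟩
      · have hne : p.1 ≠ p.2 := by
          intro h
          have hp' : δ ≤ |φ p.1 - φ p.2| := hp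
          rw [h, sub_self, abs_zero] at hp'
          linarith
        exact sub_pos.2 (hcon s _ _ hne)
      · have : G p ≤ G (x, y) := hmin (show (x, y) ∈ K from hxy)
        have e : G (x, y) = |φ x - φ y| - |φ (fSgn a s x) - φ (fSgn a s y)| := rfl
        linarith
  have hC : ∃ C, ∀ x y, |φ x - φ y| ≤ C := by
    have hc : Continuous fun p : EReal × EReal => |φ p.1 - φ p.2| := by fun_prop
    obtain ⟨C, hC⟩ := (isCompact_univ.image hc).bddAbove
    exact ⟨C, fun x y => hC ⟨(x, y), trivial, rfl⟩⟩
  obtain ⟨C, hC⟩ := hC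
  have unif : ∀ δ > 0, ∃ N, ∀ n ≥ N, ∀ ε x y, |φ (wF a n ε x) - φ (wF a n ε y)| ≤ δ := by
    intro δ hδ
    obtain ⟨η1, h1, g1⟩ := gain1 δ hδ true
    obtain ⟨η2, h2, g2⟩ := gain1 δ hδ false
    set η := min η1 η2
    have hη : 0 < η := lt_min h1 h2
    have g : ∀ s x y, δ ≤ |φ x - φ y| →
        |φ (fSgn a s x) - φ (fSgn a s y)| ≤ |φ x - φ y| - η := by
      intro s x y h
      cases s with
      | true => exact (g1 x y h).trans (by linarith [min_le_left η1 η2])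
      | false => exact (g2 x y h).trans (by linarith [min_le_right η1 η2])
    have ind : ∀ (n : ℕ) ε x y,
        |φ (wF a n ε x) - φ (wF a n ε y)| ≤ max δ (C - n * η) := by
      intro n
      induction n with
      | zero =>
        intro ε x y
        exact le_max_of_le_right (by simpa using hC _ _)
      | succ n ih =>
        intro ε x y
        have i := ih (fun k => ε (k + 1)) x y
        simp only [wF]
        rcases le_or_gt δ |φ (wF a n (fun k => ε (k + 1)) x) -
          φ (wF a n (fun k => ε (k + 1)) y)| with h | h
        · have := g (ε 0) _ _ h
          push_cast
          rcases le_max_iff.1 i with i | i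
          · exact le_max_of_le_left (by linarith)
          · exact le_max_of_le_right (by linarith)
        · exact le_max_of_le_left ((hle _ _ _).trans h.le)
    obtain ⟨N, hN⟩ := exists_nat_gt (C / η)
    refine ⟨N, fun n hn ε x y => (ind n ε x y).trans (max_le le_rfl ?_)⟩
    rw [div_lt_iff₀ hη] at hN
    have : (N : ℝ) * η ≤ n * η := by
      have : (N : ℝ) ≤ n := by exact_mod_cast hn
      gcongr
    linarith
  constructor
  · intro ε
    have hcau : CauchySeq fun n => φ (uSeq a n ε) := by
      rw [Metric.cauchySeq_iff']
      intro e he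
      obtain ⟨N, hN⟩ := unif (e / 2) (by linarith)
      refine ⟨N, fun n hn => ?_⟩
      obtain ⟨k, rfl⟩ := Nat.exists_eq_add_of_le hn
      rw [uSeq_eq, uSeq_eq, wF_add, Real.dist_eq]
      exact (hN N le_rfl _ _ _).trans_lt (by linarith)
    obtain ⟨l, hl⟩ := cauchySeq_tendsto_of_complete hcau
    obtain ⟨s, rfl⟩ := hemb.isClosed_range.mem_of_tendsto hl
      (Eventually.of_forall fun n => ⟨_, rfl⟩)
    exact ⟨s, hemb.isInducing.tendsto_nhds_iff.2 hl⟩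
  · intro x
    choose p hp using fSgn_surj a ha
    -- backward orbit
    have orb : ∀ n x, wF a n (fun k => (p ((fun z => (p z).2)^[k] x)).1)
        ((fun z => (p z).2)^[n] x) = x := by
      intro n
      induction n with
      | zero => intro x; rfl
      | succ n ih =>
        intro x
        simp only [wF, Function.iterate_succ, Function.comp]
        rw [ih]
        exact hp x
    refine ⟨fun k => (p ((fun z => (p z).2)^[k] x)).1, hemb.isInducing.tendsto_nhds_iff.2 ?_⟩
    rw [Metric.tendsto_atTop]
    intro e he
    obtain ⟨N, hN⟩ := unif (e / 2) (by linarith)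
    refine ⟨N, fun n hn => ?_⟩
    have h := hN n hn (fun k => (p ((fun z => (p z).2)^[k] x)).1) 1 ((fun z => (p z).2)^[n] x)
    rw [orb n x] at h
    simp only [Function.comp, uSeq_eq, Real.dist_eq]
    exact h.trans_lt (by linarith)

theorem suitable_param (t : ℝ) (h2 : 0 < 2 + t) (h3 : t ^ 2 ≤ 3) :
    (∀ ε : ℕ → Bool, ∃ s : EReal, Represents ((2 + t) * Real.exp (-t)) ε s) ∧
        ∀ s : EReal, Representable ((2 + t) * Real.exp (-t)) s := by
  obtain ⟨a, ha⟩ : ∃ a, a = (2 + t) * Real.exp (-t) := ⟨_, rfl⟩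
  obtain ⟨c, hc⟩ : ∃ c, c = a / Real.sqrt (4 - t ^ 2) := ⟨_, rfl⟩
  rw [← ha]
  have ha0 : 0 < a := by rw [ha]; positivity
  have hb : 0 < 4 - t ^ 2 := by linarith
  have hc0 : 0 < c := by rw [hc]; positivity
  have hφ := phiC_continuous c hc0
  have hφm : StrictMono (phiC c) := by
    apply ereal_strictMono hφ
    intro x y h
    simp only [phiC_coe]
    exact Real.arctan_strictMono (mul_lt_mul_of_pos_left h hc0)
  have hD : StrictMono fun x => phiC c x - phiC c (fSgn a true x) := by
    apply ereal_strictMono (hφ.sub (hφ.comp (fSgn_continuous a ha0 true)))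
    intro x y h
    have := diff_strictMono t h2 h3 a c ha hc h
    simpa only [Function.comp, Pi.sub_apply, fSgn_true_coe, phiC_coe] using this
  have key : ∀ x y, x < y →
      |phiC c (fSgn a true x) - phiC c (fSgn a true y)| < |phiC c x - phiC c y| := by
    intro x y h
    have i1 := hφm h
    have i2 := hφm.monotone (fSgn_true_mono a ha0 h.le)
    have i3 := hD h
    rw [abs_of_nonpos (by linarith), abs_of_nonpos (by linarith)]
    linarith
  have key2 : ∀ x y, x ≠ y →
      |phiC c (fSgn a true x) - phiC c (fSgn a true y)| < |phiC c x - phiC c y| := by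
    intro x y h
    rcases lt_or_gt_of_ne h with h | h
    · exact key x y h
    · rw [abs_sub_comm, abs_sub_comm (phiC c x)]
      exact key y x h
  refine suitable_of_contract a ha0 (phiC c) hφ hφm.injective ?_
  intro s x y h
  cases s with
  | true => exact key2 x y h
  | false =>
    rw [fSgn_false, fSgn_false, phiC_neg, phiC_neg, neg_sub_neg, abs_sub_comm]
    exact key2 x y h

/-- For `-√3 ≤ t ≤ √3`, the number `a = (2+t)·e^{-t}` is suitable; consequently
every `a ∈ [(2+√3)·e^{-√3}, e]` is suitable. -/
theorem suitable_of_param_and_interval :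
    (∀ t : ℝ, -Real.sqrt 3 ≤ t → t ≤ Real.sqrt 3 →
      ((∀ ε : ℕ → Bool, ∃ s : EReal, Represents ((2 + t) * Real.exp (-t)) ε s) ∧
        ∀ s : EReal, Representable ((2 + t) * Real.exp (-t)) s)) ∧
      ∀ a : ℝ, a ∈ Set.Icc ((2 + Real.sqrt 3) * Real.exp (-Real.sqrt 3)) (Real.exp 1) →
        ((∀ ε : ℕ → Bool, ∃ s : EReal, Represents a ε s) ∧
          ∀ s : EReal, Representable a s) := by
  have hs : Real.sqrt 3 ^ 2 = 3 := Real.sq_sqrt (by norm_num)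
  have hs0 : 0 ≤ Real.sqrt 3 := Real.sqrt_nonneg 3
  have hs2 : Real.sqrt 3 < 2 := by nlinarith
  have main : ∀ t : ℝ, -Real.sqrt 3 ≤ t → t ≤ Real.sqrt 3 →
      ((∀ ε : ℕ → Bool, ∃ s : EReal, Represents ((2 + t) * Real.exp (-t)) ε s) ∧
        ∀ s : EReal, Representable ((2 + t) * Real.exp (-t)) s) := by
    intro t h1 h2
    exact suitable_param t (by linarith) (by nlinarith)
  refine ⟨main, fun a ha => ?_⟩
  have hcont : ContinuousOn (fun t : ℝ => (2 + t) * Real.exp (-t)) (Set.Icc (-1) (Real.sqrt 3)) := by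
    fun_prop
  have hivt := intermediate_value_Icc' (by linarith) hcont
  have ha' : a ∈ Set.Icc ((2 + Real.sqrt 3) * Real.exp (-Real.sqrt 3))
      ((2 + (-1 : ℝ)) * Real.exp (-(-1))) := by
    have : (2 + (-1 : ℝ)) * Real.exp (-(-1)) = Real.exp 1 := by norm_num
    rw [this]
    exact ha
  obtain ⟨t, ⟨h1, h2⟩, rfl⟩ := hivt ha'
  have : 1 ≤ Real.sqrt 3 := by nlinarith
  exact main t (by linarith) h2
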